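/- Suppose β > 2(δ+α) − 1. Then the second moment of the likelihood ratio under the null satisfies E_{A∼ℚ}[ L(A)² ] → 1 as n → ∞. -/

import Mathlib

open Finset Filter
open scoped Classical symmDiff

noncomputable section

namespace NoisyHypergraph

/-- The set of unordered pairs of distinct vertices of `[n]`, encoded as 2-element subsets. -/
def pairs (n : ℕ) : Finset (Finset (Fin n)) :=
  (Finset.univ : Finset (Fin n)).powersetCard 2

/-- The set of `d`-element subsets of `[n]` (potential hyperedges). -/
def dsets (n d : ℕ) : Finset (Finset (Fin n)) :=
  (Finset.univ : Finset (Fin n)).powersetCard d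

/-- Projection of a hypergraph: all pairs of distinct vertices contained in some hyperedge. -/
def proj (n : ℕ) (H : Finset (Finset (Fin n))) : Finset (Finset (Fin n)) :=
  (pairs n).filter fun e => ∃ Ψ ∈ H, e ⊆ Ψ

/-- Mass function of `μ_{n,d,s}`: each `d`-subset included independently with probability `s`. -/
def mu (n d : ℕ) (s : ℝ) (H : Finset (Finset (Fin n))) : ℝ :=
  s ^ H.card * (1 - s) ^ ((dsets n d).card - H.card)

/-- Conditional mass function of the noisy projection `A` given the hypergraph `H`:
edges of `P(H)` kept with probability `p`, other pairs added with probability `q`. -/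
def condP (n : ℕ) (p q : ℝ) (H A : Finset (Finset (Fin n))) : ℝ :=
  p ^ (A ∩ proj n H).card * (1 - p) ^ (proj n H \ A).card *
    q ^ (A \ proj n H).card * (1 - q) ^ ((pairs n \ proj n H) \ A).card

/-- Erdős–Rényi `G(n,q)` mass function. -/
def er (n : ℕ) (q : ℝ) (A : Finset (Finset (Fin n))) : ℝ :=
  q ^ A.card * (1 - q) ^ ((pairs n).card - A.card)

/-- Joint planted mass function of `(H, A)` under `ℙ`. -/
def joint (n d : ℕ) (s p q : ℝ) (H A : Finset (Finset (Fin n))) : ℝ :=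
  mu n d s H * condP n p q H A

/-- Marginal law of `A` under the planted measure `ℙ`. -/
def marg (n d : ℕ) (s p q : ℝ) (A : Finset (Finset (Fin n))) : ℝ :=
  ∑ H ∈ (dsets n d).powerset, joint n d s p q H A

/-- Probability of an event under the joint planted law `ℙ`. -/
def prJoint (n d : ℕ) (s p q : ℝ)
    (E : Finset (Finset (Fin n)) → Finset (Finset (Fin n)) → Prop) : ℝ :=
  ∑ H ∈ (dsets n d).powerset, ∑ A ∈ (pairs n).powerset,
    if E H A then joint n d s p q H A else 0

/-- Probability of an event under the Erdős–Rényi law. -/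
def prER (n : ℕ) (q : ℝ) (E : Finset (Finset (Fin n)) → Prop) : ℝ :=
  ∑ A ∈ (pairs n).powerset, if E A then er n q A else 0

/-- The clique estimator `Ĥ(A)`: all `d`-subsets of `[n]` that form a clique in `A`. -/
def cliqueEst (n d : ℕ) (A : Finset (Finset (Fin n))) : Finset (Finset (Fin n)) :=
  (dsets n d).filter fun Ψ => ∀ e ∈ pairs n, e ⊆ Ψ → e ∈ A


/-- Generating function identity for `mu`. -/
lemma mu_prod (n d : ℕ) (s : ℝ) (f : Finset (Fin n) → ℝ) :
    ∑ H ∈ (dsets n d).powerset, mu n d s H * ∏ Ψ ∈ H, f Ψ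
      = ∏ Ψ ∈ dsets n d, (s * f Ψ + (1 - s)) := by
  rw [Finset.prod_add]
  refine Finset.sum_congr rfl fun H hH => ?_
  have hH' := Finset.mem_powerset.1 hH
  rw [Finset.prod_mul_distrib, Finset.prod_const, Finset.prod_const,
    Finset.card_sdiff_of_subset hH', mu]
  ring

lemma mu_nonneg (n d : ℕ) (s : ℝ) (h0 : 0 ≤ s) (h1 : s ≤ 1) (H : Finset (Finset (Fin n))) :
    0 ≤ mu n d s H := by
  unfold mu
  have : 0 ≤ 1 - s := by linarith
  positivity

lemma mu_sum (n d : ℕ) (s : ℝ) : ∑ H ∈ (dsets n d).powerset, mu n d s H = 1 := by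
  have := mu_prod n d s (fun _ => 1)
  simpa using this

lemma er_eq (n : ℕ) (q : ℝ) (A : Finset (Finset (Fin n))) (hA : A ⊆ pairs n) :
    er n q A = (∏ _e ∈ A, q) * ∏ _e ∈ pairs n \ A, (1 - q) := by
  rw [Finset.prod_const, Finset.prod_const, Finset.card_sdiff_of_subset hA, er]

lemma condP_eq (n : ℕ) (p q : ℝ) (H A : Finset (Finset (Fin n))) (hA : A ⊆ pairs n) :
    condP n p q H A = (∏ e ∈ A, if e ∈ proj n H then p else q) *
      ∏ e ∈ pairs n \ A, if e ∈ proj n H then 1 - p else 1 - q := by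
  have hP : proj n H ⊆ pairs n := Finset.filter_subset _ _
  rw [Finset.prod_ite, Finset.prod_ite]
  simp only [Finset.prod_const]
  have h1 : A.filter (fun e => e ∈ proj n H) = A ∩ proj n H := by
    ext e; simp
  have h2 : A.filter (fun e => e ∉ proj n H) = A \ proj n H := by
    ext e; simp
  have h3 : (pairs n \ A).filter (fun e => e ∈ proj n H) = proj n H \ A := by
    ext e
    simp only [Finset.mem_filter, Finset.mem_sdiff]
    constructor
    · rintro ⟨⟨_, b⟩, c⟩; exact ⟨c, b⟩
    · rintro ⟨c, b⟩; exact ⟨⟨hP c, b⟩, c⟩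
  have h4 : (pairs n \ A).filter (fun e => e ∉ proj n H) = (pairs n \ proj n H) \ A := by
    ext e
    simp only [Finset.mem_filter, Finset.mem_sdiff]
    tauto
  rw [h1, h2, h3, h4, condP]
  ring

/-- The chi-square parameter of a single pair. -/
def lam (p q : ℝ) : ℝ := (p - q) ^ 2 / (q * (1 - q))

lemma condP_pair (n : ℕ) (p q : ℝ) (hq0 : 0 < q) (hq1 : q < 1)
    (H H' : Finset (Finset (Fin n))) :
    ∑ A ∈ (pairs n).powerset, condP n p q H A * condP n p q H' A / er n q A
      = (1 + lam p q) ^ (proj n H ∩ proj n H').card := by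
  have hq1' : 0 < 1 - q := by linarith
  have hP : proj n H ⊆ pairs n := Finset.filter_subset _ _
  have key : ∑ A ∈ (pairs n).powerset, condP n p q H A * condP n p q H' A / er n q A
      = ∏ e ∈ pairs n,
        (((if e ∈ proj n H then p else q) * (if e ∈ proj n H' then p else q) / q)
        + ((if e ∈ proj n H then 1 - p else 1 - q) *
            (if e ∈ proj n H' then 1 - p else 1 - q) / (1 - q))) := by
    rw [Finset.prod_add]
    refine Finset.sum_congr rfl fun A hA => ?_
    have hA' := Finset.mem_powerset.1 hA
    rw [condP_eq n p q H A hA', condP_eq n p q H' A hA', er_eq n q A hA']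
    simp only [Finset.prod_div_distrib, Finset.prod_mul_distrib]
    rw [div_mul_div_comm]
    congr 1
    ring
  rw [key]
  have : ∀ e ∈ pairs n,
        (((if e ∈ proj n H then p else q) * (if e ∈ proj n H' then p else q) / q)
        + ((if e ∈ proj n H then 1 - p else 1 - q) *
            (if e ∈ proj n H' then 1 - p else 1 - q) / (1 - q)))
        = if e ∈ proj n H ∩ proj n H' then 1 + lam p q else 1 := by
    intro e _
    by_cases h1 : e ∈ proj n H <;> by_cases h2 : e ∈ proj n H' <;>
      simp only [h1, h2, Finset.mem_inter, if_true, if_false, and_self, and_true, and_false,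
        false_and, lam] <;> field_simp <;> ring
  rw [Finset.prod_congr rfl this, Finset.prod_ite_mem, Finset.prod_const,
    Finset.inter_eq_right.2 (Finset.inter_subset_left.trans hP)]

lemma second_moment_eq (n d : ℕ) (s p q : ℝ) (hq0 : 0 < q) (hq1 : q < 1) :
    ∑ A ∈ (pairs n).powerset, er n q A * (marg n d s p q A / er n q A) ^ 2
      = ∑ H' ∈ (dsets n d).powerset, mu n d s H' *
          ∑ H ∈ (dsets n d).powerset, mu n d s H *
            (1 + lam p q) ^ (proj n H ∩ proj n H').card := by
  have hq1' : 0 < 1 - q := by linarith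
  have h1 : ∀ A ∈ (pairs n).powerset, er n q A * (marg n d s p q A / er n q A) ^ 2
      = ∑ H' ∈ (dsets n d).powerset, ∑ H ∈ (dsets n d).powerset,
          mu n d s H' * (mu n d s H * (condP n p q H A * condP n p q H' A / er n q A)) := by
    intro A _
    have her : 0 < er n q A := by unfold er; positivity
    have : er n q A * (marg n d s p q A / er n q A) ^ 2
        = (marg n d s p q A * marg n d s p q A) / er n q A := by
      field_simp
    rw [this, marg, Finset.sum_mul_sum, Finset.sum_div]
    refine Finset.sum_congr rfl fun H' _ => ?_
    rw [Finset.sum_div]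
    refine Finset.sum_congr rfl fun H _ => ?_
    rw [joint, joint]
    ring
  rw [Finset.sum_congr rfl h1, Finset.sum_comm]
  refine Finset.sum_congr rfl fun H' _ => ?_
  rw [Finset.sum_comm, Finset.mul_sum]
  refine Finset.sum_congr rfl fun H _ => ?_
  rw [← Finset.mul_sum, ← Finset.mul_sum, condP_pair n p q hq0 hq1]

lemma one_add_pow_bound (x : ℝ) (h0 : 0 ≤ x) (h1 : x ≤ 1) (N : ℕ) :
    (1 + x) ^ N ≤ 1 + x * N * 2 ^ N := by
  induction N with
  | zero => simp
  | succ k ih =>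
    have hk : (0 : ℝ) ≤ k * 2 ^ k := by positivity
    have h2 : (1 : ℝ) ≤ 2 ^ k := one_le_pow₀ (by norm_num)
    calc (1 + x) ^ (k + 1) = (1 + x) ^ k * (1 + x) := pow_succ _ _
      _ ≤ (1 + x * k * 2 ^ k) * (1 + x) := by gcongr
      _ ≤ 1 + x * (k + 1 : ℕ) * 2 ^ (k + 1) := by
        push_cast
        rw [pow_succ]
        nlinarith [mul_nonneg h0 hk, mul_nonneg (mul_nonneg h0 hk) (sub_nonneg.2 h1),
          mul_nonneg h0 (sub_nonneg.2 h2)]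

lemma proj_card_le (n d : ℕ) (H : Finset (Finset (Fin n))) (hH : H ⊆ dsets n d) :
    (proj n H).card ≤ H.card * 2 ^ d := by
  have : proj n H ⊆ H.biUnion fun Ψ => Ψ.powerset := by
    intro e he
    obtain ⟨_, Ψ, h1, h2⟩ := Finset.mem_filter.1 he
    exact Finset.mem_biUnion.2 ⟨Ψ, h1, Finset.mem_powerset.2 h2⟩
  refine (Finset.card_le_card this).trans (Finset.card_biUnion_le_card_mul _ _ _ ?_)
  intro Ψ hΨ
  rw [Finset.card_powerset, (Finset.mem_powersetCard.1 (hH hΨ)).2]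

lemma proj_inter_le (n : ℕ) (H P : Finset (Finset (Fin n))) :
    (proj n H ∩ P).card ≤ ∑ Ψ ∈ H, (P.filter fun e => e ⊆ Ψ).card := by
  have : proj n H ∩ P ⊆ H.biUnion fun Ψ => P.filter fun e => e ⊆ Ψ := by
    intro e he
    obtain ⟨he, hP⟩ := Finset.mem_inter.1 he
    obtain ⟨_, Ψ, h1, h2⟩ := Finset.mem_filter.1 he
    exact Finset.mem_biUnion.2 ⟨Ψ, h1, Finset.mem_filter.2 ⟨hP, h2⟩⟩
  exact (Finset.card_le_card this).trans Finset.card_biUnion_le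

lemma count_super (n d : ℕ) (e : Finset (Fin n)) (he : e ∈ pairs n) :
    ((dsets n d).filter fun Ψ => e ⊆ Ψ).card ≤ n ^ (d - 2) := by
  have h2 : e.card = 2 := (Finset.mem_powersetCard.1 he).2
  have : ((dsets n d).filter fun Ψ => e ⊆ Ψ).card
      ≤ ((Finset.univ : Finset (Fin n)).powersetCard (d - 2)).card := by
    refine Finset.card_le_card_of_injOn (fun Ψ => Ψ \ e) ?_ ?_
    · intro Ψ hΨ
      obtain ⟨h3, h4⟩ := Finset.mem_filter.1 hΨ
      refine Finset.mem_coe.2 (Finset.mem_powersetCard.2 ⟨Finset.subset_univ _, ?_⟩)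
      rw [Finset.card_sdiff_of_subset h4, (Finset.mem_powersetCard.1 h3).2, h2]
    · intro Ψ hΨ Φ hΦ h
      have h4 := (Finset.mem_filter.1 hΨ).2
      have h5 := (Finset.mem_filter.1 hΦ).2
      have h6 : Ψ \ e = Φ \ e := h
      rw [← Finset.sdiff_union_of_subset h4, ← Finset.sdiff_union_of_subset h5, h6]
  refine this.trans ?_
  rw [Finset.card_powersetCard, Finset.card_univ, Fintype.card_fin]
  exact Nat.choose_le_pow _ _

lemma sum_count (n d : ℕ) (P : Finset (Finset (Fin n))) (hP : P ⊆ pairs n) :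
    ∑ Ψ ∈ dsets n d, (P.filter fun e => e ⊆ Ψ).card ≤ P.card * n ^ (d - 2) := by
  have : ∑ Ψ ∈ dsets n d, (P.filter fun e => e ⊆ Ψ).card
      = ∑ e ∈ P, ((dsets n d).filter fun Ψ => e ⊆ Ψ).card := by
    simp only [Finset.card_filter]
    exact Finset.sum_comm
  rw [this]
  calc _ ≤ ∑ _e ∈ P, n ^ (d - 2) := Finset.sum_le_sum fun e he => count_super n d e (hP he)
    _ = _ := by simp

/-- Bound for the inner expectation. -/
lemma inner_bound (n d : ℕ) (s x : ℝ) (hs0 : 0 ≤ s) (hs1 : s ≤ 1) (hx0 : 0 ≤ x) (hx1 : x ≤ 1)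
    (H' : Finset (Finset (Fin n))) (hH' : H' ⊆ dsets n d) :
    ∑ H ∈ (dsets n d).powerset, mu n d s H * (1 + x) ^ (proj n H ∩ proj n H').card
      ≤ Real.exp (s * x * 2 ^ (2 ^ d) * n ^ (d - 2) * 2 ^ d) ^ H'.card := by
  set P := proj n H' with hPdef
  have hP : P ⊆ pairs n := Finset.filter_subset _ _
  set N : Finset (Fin n) → ℕ := fun Ψ => (P.filter fun e => e ⊆ Ψ).card with hN
  have hNle : ∀ Ψ ∈ dsets n d, N Ψ ≤ 2 ^ d := by
    intro Ψ hΨ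
    rw [← (Finset.mem_powersetCard.1 hΨ).2, ← Finset.card_powerset]
    refine Finset.card_le_card fun e he => ?_
    exact Finset.mem_powerset.2 (Finset.mem_filter.1 he).2
  calc _ ≤ ∑ H ∈ (dsets n d).powerset, mu n d s H * ∏ Ψ ∈ H, (1 + x) ^ N Ψ := by
        refine Finset.sum_le_sum fun H _ => ?_
        refine mul_le_mul_of_nonneg_left ?_ (mu_nonneg n d s hs0 hs1 H)
        rw [Finset.prod_pow_eq_pow_sum]
        exact pow_le_pow_right₀ (by linarith) (proj_inter_le n H P)
    _ = ∏ Ψ ∈ dsets n d, (s * (1 + x) ^ N Ψ + (1 - s)) := mu_prod n d s _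
    _ ≤ ∏ Ψ ∈ dsets n d, Real.exp (s * x * 2 ^ (2 ^ d) * N Ψ) := by
        refine Finset.prod_le_prod (fun Ψ _ => ?_) (fun Ψ hΨ => ?_)
        · have : 0 ≤ 1 - s := by linarith
          positivity
        · have h1 := one_add_pow_bound x hx0 hx1 (N Ψ)
          have h2 : (2 : ℝ) ^ N Ψ ≤ 2 ^ (2 ^ d) :=
            pow_le_pow_right₀ (by norm_num) (hNle Ψ hΨ)
          have h3 : x * N Ψ * 2 ^ N Ψ ≤ x * N Ψ * 2 ^ (2 ^ d) := by gcongr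
          have h4 := Real.add_one_le_exp (s * x * 2 ^ (2 ^ d) * N Ψ)
          have h5 : s * (1 + x) ^ N Ψ ≤ s * (1 + x * N Ψ * 2 ^ (2 ^ d)) := by
            gcongr
            linarith
          linarith
    _ = Real.exp (s * x * 2 ^ (2 ^ d) * (∑ Ψ ∈ dsets n d, N Ψ : ℕ)) := by
        rw [← Real.exp_sum, ← Finset.mul_sum]
        push_cast
        rfl
    _ ≤ Real.exp (s * x * 2 ^ (2 ^ d) * (H'.card * 2 ^ d * n ^ (d - 2) : ℕ)) := by
        refine Real.exp_le_exp.2 (mul_le_mul_of_nonneg_left ?_ (by positivity))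
        refine Nat.cast_le.2 ((sum_count n d P hP).trans ?_)
        exact Nat.mul_le_mul_right _ (proj_card_le n d H' hH')
    _ = _ := by
        rw [← Real.exp_nat_mul]
        congr 1
        push_cast
        ring

lemma total_bound (n d : ℕ) (s x : ℝ) (hs0 : 0 ≤ s) (hs1 : s ≤ 1) (hx0 : 0 ≤ x) (hx1 : x ≤ 1)
    (ht : s * x * 2 ^ (2 ^ d) * n ^ (d - 2) * 2 ^ d ≤ 1) :
    ∑ H' ∈ (dsets n d).powerset, mu n d s H' *
          ∑ H ∈ (dsets n d).powerset, mu n d s H * (1 + x) ^ (proj n H ∩ proj n H').card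
      ≤ Real.exp (n ^ d * (s * (2 * (s * x * 2 ^ (2 ^ d) * n ^ (d - 2) * 2 ^ d)))) := by
  set t := s * x * 2 ^ (2 ^ d) * n ^ (d - 2) * 2 ^ d with htdef
  have ht0 : 0 ≤ t := by positivity
  calc _ ≤ ∑ H' ∈ (dsets n d).powerset, mu n d s H' * ∏ _Ψ ∈ H', Real.exp t := by
        refine Finset.sum_le_sum fun H' hH' => ?_
        refine mul_le_mul_of_nonneg_left ?_ (mu_nonneg n d s hs0 hs1 H')
        rw [Finset.prod_const]
        exact inner_bound n d s x hs0 hs1 hx0 hx1 H' (Finset.mem_powerset.1 hH')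
    _ = ∏ _Ψ ∈ dsets n d, (s * Real.exp t + (1 - s)) := mu_prod n d s _
    _ ≤ ∏ _Ψ ∈ dsets n d, Real.exp (s * (2 * t)) := by
        refine Finset.prod_le_prod (fun Ψ _ => ?_) (fun Ψ hΨ => ?_)
        · have : 0 ≤ 1 - s := by linarith
          positivity
        · have h1 : Real.exp t ≤ 1 + 2 * t := by
            have := Real.abs_exp_sub_one_le (x := t) (by rwa [abs_of_nonneg ht0])
            rw [abs_of_nonneg ht0] at this
            linarith [le_abs_self (Real.exp t - 1)]
          have h4 := Real.add_one_le_exp (s * (2 * t))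
          have h5 : s * Real.exp t ≤ s * (1 + 2 * t) := by gcongr
          linarith
    _ = Real.exp ((dsets n d).card * (s * (2 * t))) := by
        rw [Finset.prod_const, ← Real.exp_nat_mul]
    _ ≤ _ := by
        refine Real.exp_le_exp.2 (mul_le_mul_of_nonneg_right ?_ (by positivity))
        have : (dsets n d).card ≤ n ^ d := by
          rw [dsets, Finset.card_powersetCard, Finset.card_univ, Fintype.card_fin]
          exact Nat.choose_le_pow _ _
        exact_mod_cast this

lemma total_ge_one (n d : ℕ) (s x : ℝ) (hs0 : 0 ≤ s) (hs1 : s ≤ 1) (hx0 : 0 ≤ x) :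
    1 ≤ ∑ H' ∈ (dsets n d).powerset, mu n d s H' *
          ∑ H ∈ (dsets n d).powerset, mu n d s H * (1 + x) ^ (proj n H ∩ proj n H').card := by
  have h : ∀ H' : Finset (Finset (Fin n)), 1 ≤ ∑ H ∈ (dsets n d).powerset,
      mu n d s H * (1 + x) ^ (proj n H ∩ proj n H').card := by
    intro H'
    refine (mu_sum n d s).symm.le.trans ?_
    refine Finset.sum_le_sum fun H _ => ?_
    exact le_mul_of_one_le_right (mu_nonneg n d s hs0 hs1 H) (one_le_pow₀ (by linarith))
  calc (1 : ℝ) = ∑ H' ∈ (dsets n d).powerset, mu n d s H' := (mu_sum n d s).symm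
    _ ≤ _ := Finset.sum_le_sum fun H' _ =>
      le_mul_of_one_le_right (mu_nonneg n d s hs0 hs1 H') (h H')

lemma tendsto_zero_of_log (x : ℕ → ℝ) (hx : ∀ᶠ n in atTop, 0 < x n) (c : ℝ) (hc : c < 0)
    (h : Tendsto (fun n : ℕ => Real.log (x n) / Real.log n) atTop (nhds c)) :
    Tendsto x atTop (nhds 0) := by
  have hlog : Tendsto (fun n : ℕ => Real.log (n : ℝ)) atTop atTop :=
    Real.tendsto_log_atTop.comp tendsto_natCast_atTop_atTop
  have h1 : Tendsto (fun n : ℕ => Real.log (x n) / Real.log n * Real.log n) atTop atBot :=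
    h.neg_mul_atTop hc hlog
  refine (Real.tendsto_exp_atBot.comp h1).congr' ?_
  filter_upwards [hx, hlog.eventually_gt_atTop 0] with n hn hl
  simp only [Function.comp]
  rw [div_mul_cancel₀ _ hl.ne', Real.exp_log hn]

lemma lam_nonneg (p q : ℝ) (hq0 : 0 < q) (hq1 : q < 1) : 0 ≤ lam p q := by
  unfold lam
  have : 0 < 1 - q := by linarith
  positivity

lemma lam_le (p q : ℝ) (hq0 : 0 < q) (hq1 : q ≤ 1 / 2) (hqp : q ≤ p) :
    lam p q ≤ 2 * (p ^ 2 / q) := by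
  unfold lam
  have h1 : 0 < 1 - q := by linarith
  rw [← mul_div_assoc, div_le_div_iff₀ (by positivity) hq0]
  have h2 : (p - q) ^ 2 ≤ p ^ 2 := by nlinarith
  have h3 : p ^ 2 * q ≤ 2 * p ^ 2 * (q * (1 - q)) := by
    have : 0 ≤ p ^ 2 * q := by positivity
    nlinarith
  nlinarith

lemma pow_scale (s p q : ℕ → ℝ) (hs0 : ∀ n, 0 < s n) (hp0 : ∀ n, 0 < p n) (hq0 : ∀ n, 0 < q n)
    (a b c : ℝ) (i k : ℕ)
    (hs : Tendsto (fun n : ℕ => Real.log (s n) / Real.log n) atTop (nhds a))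
    (hp : Tendsto (fun n : ℕ => Real.log (p n) / Real.log n) atTop (nhds b))
    (hq : Tendsto (fun n : ℕ => Real.log (q n) / Real.log n) atTop (nhds c))
    (hneg : i * a + k + (2 * b - c) < 0) :
    Tendsto (fun n : ℕ => s n ^ i * (n : ℝ) ^ k * (p n ^ 2 / q n)) atTop (nhds 0) := by
  have hlog : Tendsto (fun n : ℕ => Real.log (n : ℝ)) atTop atTop :=
    Real.tendsto_log_atTop.comp tendsto_natCast_atTop_atTop
  refine tendsto_zero_of_log _ ?_ _ hneg ?_
  · filter_upwards [eventually_gt_atTop 0] with n hn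
    have := hs0 n
    have := hp0 n
    have := hq0 n
    have : (0 : ℝ) < n := by exact_mod_cast hn
    positivity
  · have h := ((hs.const_mul (i : ℝ)).add_const (k : ℝ)).add ((hp.const_mul 2).sub hq)
    refine h.congr' ?_
    filter_upwards [eventually_gt_atTop 0, hlog.eventually_gt_atTop 0] with n hn hl
    have h1 := (hs0 n).ne'
    have h2 := (hp0 n).ne'
    have h3 := (hq0 n).ne'
    have h4 : (n : ℝ) ≠ 0 := by exact_mod_cast hn.ne'
    rw [Real.log_mul (by positivity) (by positivity), Real.log_mul (by positivity) (by positivity),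
      Real.log_div (by positivity) h3, Real.log_pow, Real.log_pow, Real.log_pow]
    have h5 := hl.ne'
    field_simp
    push_cast
    ring

/-- when `β > 2(δ+α) − 1`, the second moment of the likelihood ratio
`L(A) = ℙ(A)/ℚ(A)` under the null satisfies `E_ℚ[L(A)²] → 1`. -/
theorem likelihood_second_moment_to_one
    (d : ℕ) (hd : 2 ≤ d) (δ α β : ℝ)
    (hδ : 0 ≤ δ ∧ δ < 1) (hβα : 0 ≤ β ∧ β ≤ α ∧ α ≤ 1)
    (hgap : 2 * (δ + α) - 1 < β)
    (s p q : ℕ → ℝ)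
    (hs01 : ∀ n, 0 < s n ∧ s n ≤ 1)
    (hp01 : ∀ n, 0 ≤ p n ∧ p n ≤ 1)
    (hq01 : ∀ n, 0 < q n ∧ q n ≤ 1)
    (hqp : ∀ n, q n ≤ p n)
    (hs : Tendsto (fun n : ℕ => Real.log (s n) / Real.log n) atTop
      (nhds (-((d : ℝ) - 1) + δ)))
    (hp : Tendsto (fun n : ℕ => Real.log (p n) / Real.log n) atTop (nhds (-1 + α)))
    (hq : Tendsto (fun n : ℕ => Real.log (q n) / Real.log n) atTop (nhds (-1 + β))) :
    Tendsto (fun n : ℕ =>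
        ∑ A ∈ (pairs n).powerset,
          er n (q n) A * (marg n d (s n) (p n) (q n) A / er n (q n) A) ^ 2)
      atTop (nhds 1) := by
  have hs0 : ∀ n, 0 < s n := fun n => (hs01 n).1
  have hq0 : ∀ n, 0 < q n := fun n => (hq01 n).1
  have hp0 : ∀ n, 0 < p n := fun n => (hq0 n).trans_le (hqp n)
  obtain ⟨hδ0, hδ1⟩ := hδ
  obtain ⟨hβ0, hβα', hα1⟩ := hβα
  obtain ⟨m, rfl⟩ : ∃ m, d = m + 2 := ⟨d - 2, by omega⟩
  have hqt : Tendsto q atTop (nhds 0) :=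
    tendsto_zero_of_log q (Eventually.of_forall hq0) _ (by linarith) hq
  have T1 := pow_scale s p q hs0 hp0 hq0 _ _ _ 0 0 hs hp hq (by push_cast; linarith)
  have T2 := pow_scale s p q hs0 hp0 hq0 _ _ _ 1 m hs hp hq (by push_cast; linarith)
  have T3 := pow_scale s p q hs0 hp0 hq0 _ _ _ 2 (m + 2 + m) hs hp hq (by push_cast; linarith)
  set K : ℝ := 2 ^ (2 ^ (m + 2)) * 2 ^ (m + 2) with hK
  have hK0 : 0 < K := by positivity
  have T1' := T1.const_mul 2
  have T2' := T2.const_mul (2 * K)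
  have T3' := (Real.continuous_exp.tendsto _).comp (T3.const_mul (4 * K))
  rw [mul_zero] at T1' T2' T3'
  rw [Real.exp_zero] at T3'
  refine tendsto_of_tendsto_of_tendsto_of_le_of_le' tendsto_const_nhds T3' ?_ ?_
  · filter_upwards [hqt.eventually_lt_const (show (0 : ℝ) < 1 / 2 by norm_num)] with n hn
    rw [second_moment_eq n _ _ _ _ (hq0 n) (by linarith)]
    exact total_ge_one n _ _ _ (hs0 n).le (hs01 n).2 (lam_nonneg _ _ (hq0 n) (by linarith))
  · filter_upwards [hqt.eventually_lt_const (show (0 : ℝ) < 1 / 2 by norm_num),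
      T1'.eventually_lt_const one_pos, T2'.eventually_lt_const one_pos] with n hn h1 h2
    rw [second_moment_eq n _ _ _ _ (hq0 n) (by linarith)]
    have hl0 := lam_nonneg (p n) _ (hq0 n) (by linarith)
    have hl := lam_le (p n) (q n) (hq0 n) hn.le (hqp n)
    have hsn := hs0 n
    simp only [pow_zero, one_mul, pow_one] at h1 h2
    have ht : s n * lam (p n) (q n) * 2 ^ (2 ^ (m + 2)) * (n : ℝ) ^ (m + 2 - 2) * 2 ^ (m + 2)
        ≤ 2 * K * (s n * (n : ℝ) ^ m * (p n ^ 2 / q n)) := by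
      rw [Nat.add_sub_cancel]
      calc _ = K * (s n * (n : ℝ) ^ m) * lam (p n) (q n) := by rw [hK]; ring
        _ ≤ K * (s n * (n : ℝ) ^ m) * (2 * (p n ^ 2 / q n)) := by gcongr
        _ = _ := by ring
    refine (total_bound n _ _ _ hsn.le (hs01 n).2 hl0 (by linarith) (by linarith)).trans ?_
    simp only [Function.comp]
    refine Real.exp_le_exp.2 ?_
    calc _ ≤ (n : ℝ) ^ (m + 2) * (s n * (2 * (2 * K * (s n * (n : ℝ) ^ m * (p n ^ 2 / q n))))) := by
          gcongr
      _ = _ := by rw [pow_add (n : ℝ) (m + 2) m]; ring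


end NoisyHypergraph
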